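/- For all ℓ ≥ 1 and all n ≥ 3 + ℓ, the highest power of x that occurs in the polynomial Q_{n,132}^{(0,1,ℓ,1)}(x) is x^{n-2-ℓ}, and its coefficient equals C_ℓ; that is, the coefficient of x^{n-2-ℓ} in Q_{n,132}^{(0,1,ℓ,1)}(x) is C_ℓ and the coefficient of x^r is 0 for every r > n-2-ℓ. -/

import Mathlib

open Finset Polynomial

/-- `σ i` matches the quadrant marked mesh pattern `MMP(a,b,c,d)` in `σ`:
there are at least `a` indices `j > i` with `σ j > σ i`, at least `b` indices
`j < i` with `σ j > σ i`, at least `c` indices `j < i` with `σ j < σ i`, and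
at least `d` indices `j > i` with `σ j < σ i`. -/
def MatchesMMP {n : ℕ} (a b c d : ℕ) (σ : Equiv.Perm (Fin n)) (i : Fin n) : Prop :=
  a ≤ (Finset.univ.filter (fun j => i < j ∧ σ i < σ j)).card ∧
  b ≤ (Finset.univ.filter (fun j => j < i ∧ σ i < σ j)).card ∧
  c ≤ (Finset.univ.filter (fun j => j < i ∧ σ j < σ i)).card ∧
  d ≤ (Finset.univ.filter (fun j => i < j ∧ σ j < σ i)).card

instance {n : ℕ} (a b c d : ℕ) (σ : Equiv.Perm (Fin n)) :
    DecidablePred (MatchesMMP a b c d σ) := fun i => by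
  unfold MatchesMMP; infer_instance

/-- `mmp a b c d σ` is the number of indices `i` such that `σ i` matches
`MMP(a,b,c,d)` in `σ`. -/
def mmp {n : ℕ} (a b c d : ℕ) (σ : Equiv.Perm (Fin n)) : ℕ :=
  (Finset.univ.filter (MatchesMMP a b c d σ)).card

/-- `σ` avoids the classical pattern 132. -/
def Avoids132 {n : ℕ} (σ : Equiv.Perm (Fin n)) : Prop :=
  ¬ ∃ i j k : Fin n, i < j ∧ j < k ∧ σ i < σ k ∧ σ k < σ j

instance {n : ℕ} : DecidablePred (Avoids132 (n := n)) := fun σ => by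
  unfold Avoids132; infer_instance

/-- The set `S_n(132)` of 132-avoiding permutations of `{1,…,n}`. -/
def Av132 (n : ℕ) : Finset (Equiv.Perm (Fin n)) :=
  Finset.univ.filter Avoids132

/-- `Q n a b c d = Σ_{σ ∈ S_n(132)} x^{mmp^{(a,b,c,d)}(σ)}`, a polynomial in `ℤ[x]`. -/
noncomputable def Q (n a b c d : ℕ) : Polynomial ℤ :=
  ∑ σ ∈ Av132 n, Polynomial.X ^ (mmp a b c d σ)

lemma val_eq_card {n : ℕ} (σ : Equiv.Perm (Fin n)) (i : Fin n) :
    (σ i : ℕ) = (Finset.univ.filter (fun j => σ j < σ i)).card := by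
  have h : (Finset.univ.filter (fun j => σ j < σ i)).map σ.toEmbedding = Finset.Iio (σ i) := by
    ext x
    simp only [Finset.mem_map, Finset.mem_filter, Finset.mem_univ, true_and, Finset.mem_Iio]
    constructor
    · rintro ⟨a, ha, rfl⟩
      exact ha
    · intro hx
      exact ⟨σ.symm x, by simpa using hx, by simp⟩
  rw [← Finset.card_map σ.toEmbedding, h, Fin.card_Iio]

/-- an injective self map of `Fin n` as a permutation -/
noncomputable def permOf {n : ℕ} (f : Fin n → Fin n) (hf : Function.Injective f) :
    Equiv.Perm (Fin n) :=
  Equiv.ofBijective f (Finite.injective_iff_bijective.mp hf)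

lemma permOf_apply {n : ℕ} (f : Fin n → Fin n) (hf : Function.Injective f) (i : Fin n) :
    permOf f hf i = f i := rfl

/-- glue two words around the maximum -/
def glueFun {k m : ℕ} (α : Equiv.Perm (Fin k)) (β : Equiv.Perm (Fin m)) (i : Fin (k + m + 1)) :
    Fin (k + m + 1) :=
  if h : (i : ℕ) < k then ⟨(α ⟨i, h⟩ : ℕ) + m, by have := (α ⟨i, h⟩).2; omega⟩
  else if h2 : (i : ℕ) = k then ⟨k + m, by omega⟩
  else ⟨(β ⟨(i : ℕ) - k - 1, by have := i.2; omega⟩ : ℕ),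
    by have := (β ⟨(i : ℕ) - k - 1, by have := i.2; omega⟩).2; omega⟩

lemma glue_left {k m : ℕ} (α : Equiv.Perm (Fin k)) (β : Equiv.Perm (Fin m)) (i : Fin (k + m + 1))
    (h : (i : ℕ) < k) : (glueFun α β i : ℕ) = (α ⟨i, h⟩ : ℕ) + m := by
  simp [glueFun, h]

lemma glue_mid {k m : ℕ} (α : Equiv.Perm (Fin k)) (β : Equiv.Perm (Fin m)) (i : Fin (k + m + 1))
    (h : (i : ℕ) = k) : (glueFun α β i : ℕ) = k + m := by
  simp [glueFun, h]

lemma glue_right {k m : ℕ} (α : Equiv.Perm (Fin k)) (β : Equiv.Perm (Fin m)) (i : Fin (k + m + 1))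
    (h : k < (i : ℕ)) : (glueFun α β i : ℕ) =
      (β ⟨(i : ℕ) - k - 1, by have := i.2; omega⟩ : ℕ) := by
  have h1 : ¬ (i : ℕ) < k := by omega
  have h2 : ¬ (i : ℕ) = k := by omega
  simp [glueFun, h1, h2]

lemma perm_val_inj {n : ℕ} (σ : Equiv.Perm (Fin n)) {i j : Fin n}
    (h : (σ i : ℕ) = (σ j : ℕ)) : (i : ℕ) = j := by
  have := σ.injective (Fin.ext h)
  rw [this]

lemma glue_inj {k m : ℕ} (α : Equiv.Perm (Fin k)) (β : Equiv.Perm (Fin m)) :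
    Function.Injective (glueFun α β) := by
  intro i j hij
  have hv : (glueFun α β i : ℕ) = glueFun α β j := by rw [hij]
  apply Fin.ext
  rcases lt_trichotomy (i : ℕ) k with hi | hi | hi <;>
  rcases lt_trichotomy (j : ℕ) k with hj | hj | hj
  · rw [glue_left α β i hi, glue_left α β j hj] at hv
    have := perm_val_inj α (Nat.add_right_cancel hv)
    simpa using this
  · rw [glue_left α β i hi, glue_mid α β j hj] at hv
    have := (α ⟨i, hi⟩).2; omega
  · rw [glue_left α β i hi, glue_right α β j hj] at hv
    have := (β ⟨(j : ℕ) - k - 1, by have := j.2; omega⟩).2; omega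
  · rw [glue_mid α β i hi, glue_left α β j hj] at hv
    have := (α ⟨j, hj⟩).2; omega
  · omega
  · rw [glue_mid α β i hi, glue_right α β j hj] at hv
    have := (β ⟨(j : ℕ) - k - 1, by have := j.2; omega⟩).2; omega
  · rw [glue_right α β i hi, glue_left α β j hj] at hv
    have := (β ⟨(i : ℕ) - k - 1, by have := i.2; omega⟩).2; omega
  · rw [glue_right α β i hi, glue_mid α β j hj] at hv
    have := (β ⟨(i : ℕ) - k - 1, by have := i.2; omega⟩).2; omega
  · rw [glue_right α β i hi, glue_right α β j hj] at hv
    have := perm_val_inj β hv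
    simp only at this
    omega

lemma glue_avoids {k m : ℕ} (α : Equiv.Perm (Fin k)) (β : Equiv.Perm (Fin m))
    (hα : Avoids132 α) (hβ : Avoids132 β) : Avoids132 (permOf (glueFun α β) (glue_inj α β)) := by
  rintro ⟨a, b, c, hab, hbc, h1, h2⟩
  simp only [permOf_apply, Fin.lt_def] at *
  have key : ∀ i : Fin (k + m + 1), ((i : ℕ) < k → m ≤ (glueFun α β i : ℕ)) ∧
      (k < (i : ℕ) → (glueFun α β i : ℕ) < m) ∧ (glueFun α β i : ℕ) ≤ k + m ∧
      ((i : ℕ) = k → (glueFun α β i : ℕ) = k + m) := by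
    intro i
    refine ⟨fun h => by rw [glue_left α β i h]; omega, fun h => by rw [glue_right α β i h]; simp,
      by have := (glueFun α β i).2; omega, fun h => glue_mid α β i h⟩
  have ka := key a
  have kb := key b
  have kc := key c
  by_cases hc : (c : ℕ) < k
  · rw [glue_left α β a (by omega), glue_left α β c hc] at h1
    rw [glue_left α β b (by omega), glue_left α β c hc] at h2
    exact hα ⟨⟨a, by omega⟩, ⟨b, by omega⟩, ⟨c, hc⟩, hab, hbc, by
      rw [Fin.lt_def]; omega, by rw [Fin.lt_def]; omega⟩
  · by_cases ha : k < (a : ℕ)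
    · rw [glue_right α β a ha, glue_right α β c (by omega)] at h1
      rw [glue_right α β b (by omega), glue_right α β c (by omega)] at h2
      exact hβ ⟨_, _, _, by rw [Fin.lt_def]; dsimp only; omega,
        by rw [Fin.lt_def]; dsimp only; omega, h1, h2⟩
    · omega

lemma card_split (k m : ℕ) :
    ((Av132 (k + m + 1)).filter (fun σ => (σ ⟨k, by omega⟩ : ℕ) = k + m)).card =
      (Av132 k).card * (Av132 m).card := by
  rw [← Finset.card_product]
  symm
  apply Finset.card_bij (fun p _ => permOf (glueFun p.1 p.2) (glue_inj p.1 p.2))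
  · rintro ⟨α, β⟩ h
    simp only [Av132, Finset.mem_product, Finset.mem_filter, Finset.mem_univ, true_and] at h ⊢
    exact ⟨glue_avoids α β h.1 h.2, glue_mid α β _ rfl⟩
  · rintro ⟨α, β⟩ _ ⟨α', β'⟩ _ h
    have hh : ∀ i, (glueFun α β i : ℕ) = glueFun α' β' i := fun i => by
      have := congrArg (fun e : Equiv.Perm (Fin (k + m + 1)) => (e i : ℕ)) h
      exact this
    congr 1
    · ext i
      have := hh ⟨i, by have := i.2; omega⟩
      rw [glue_left _ _ _ i.2, glue_left _ _ _ i.2] at this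
      simpa using this
    · ext i
      have hk : k < ((⟨k + 1 + i, by have := i.2; omega⟩ : Fin (k + m + 1)) : ℕ) := by
        dsimp only; omega
      have := hh ⟨k + 1 + i, by have := i.2; omega⟩
      rw [glue_right _ _ _ hk, glue_right _ _ _ hk] at this
      have e : k + 1 + (i : ℕ) - k - 1 = i := by omega
      simpa [e] using this
  · intro σ hσ
    simp only [Av132, Finset.mem_filter, Finset.mem_univ, true_and] at hσ
    obtain ⟨hav, hmax⟩ := hσ
    set K : Fin (k + m + 1) := ⟨k, by omega⟩ with hK
    have hlt : ∀ i, i ≠ K → (σ i : ℕ) < k + m := by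
      intro i hi
      have h1 := (σ i).2
      have h2 : (σ i : ℕ) ≠ σ K := fun h => hi (σ.injective (Fin.ext h))
      omega
    have hdec : ∀ i j : Fin (k + m + 1), i ≤ K → K < j → σ j < σ i := by
      intro i j hi hj
      rcases eq_or_lt_of_le hi with rfl | hi
      · have := hlt j hj.ne'
        rw [Fin.lt_def]; omega
      · by_contra hc
        have hne : σ i ≠ σ j := fun h => (hi.trans hj).ne (σ.injective h)
        have h2 := hlt j hj.ne'
        exact hav ⟨i, K, j, hi, hj, lt_of_le_of_ne (not_lt.mp hc) hne, by
          rw [Fin.lt_def]; omega⟩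
    have hcardK : (Finset.Ioi K).card = m := by
      rw [Fin.card_Ioi]; simp [hK]
    have hR : ∀ j, K < j → (σ j : ℕ) < m := by
      intro j hj
      rw [val_eq_card]
      refine lt_of_lt_of_eq ?_ hcardK
      apply Finset.card_lt_card
      rw [Finset.ssubset_iff_of_subset]
      · exact ⟨j, by simpa using hj, by simp⟩
      · intro t ht
        simp only [Finset.mem_filter, Finset.mem_univ, true_and, Finset.mem_Ioi] at ht ⊢
        by_contra hc
        exact absurd (hdec t j (not_lt.mp hc) hj) (not_lt.mpr ht.le)
    have hL : ∀ i, i < K → m ≤ (σ i : ℕ) := by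
      intro i hi
      rw [val_eq_card]
      refine hcardK.ge.trans ?_
      apply Finset.card_le_card
      intro t ht
      simp only [Finset.mem_filter, Finset.mem_univ, true_and, Finset.mem_Ioi] at ht ⊢
      exact hdec i t hi.le ht
    let P : Fin k → Fin (k + m + 1) := fun i => ⟨i, by omega⟩
    let R : Fin m → Fin (k + m + 1) := fun i => ⟨k + 1 + i, by omega⟩
    have hP : ∀ i, P i < K := fun i => by rw [Fin.lt_def]; exact i.2
    have hRK : ∀ i, K < R i := fun i => by rw [Fin.lt_def]; simp only [hK, R]; omega
    have fi : Function.Injective (fun i : Fin k => (⟨(σ (P i) : ℕ) - m, by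
        have := hL _ (hP i); have := hlt _ (hP i).ne; omega⟩ : Fin k)) := by
      intro i j hij
      simp only [Fin.mk.injEq] at hij
      have h1 := hL _ (hP i)
      have h2 := hL _ (hP j)
      have := perm_val_inj σ (i := P i) (j := P j) (by omega)
      exact Fin.ext this
    have gi : Function.Injective (fun i : Fin m => (⟨(σ (R i) : ℕ), hR _ (hRK i)⟩ : Fin m)) := by
      intro i j hij
      simp only [Fin.mk.injEq] at hij
      have := perm_val_inj σ hij
      simp only [R] at this
      apply Fin.ext; omega
    refine ⟨(permOf _ fi, permOf _ gi), ?_, ?_⟩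
    · simp only [Av132, Finset.mem_product, Finset.mem_filter, Finset.mem_univ, true_and]
      constructor
      · rintro ⟨a, b, c, hab, hbc, h1, h2⟩
        simp only [permOf_apply, Fin.lt_def] at h1 h2
        have hA := hL _ (hP a)
        have hB := hL _ (hP b)
        have hC := hL _ (hP c)
        exact hav ⟨P a, P b, P c, hab, hbc, by rw [Fin.lt_def]; omega, by rw [Fin.lt_def]; omega⟩
      · rintro ⟨a, b, c, hab, hbc, h1, h2⟩
        simp only [permOf_apply, Fin.lt_def] at h1 h2
        exact hav ⟨R a, R b, R c, by rw [Fin.lt_def] at *; simp only [R]; omega,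
          by rw [Fin.lt_def] at *; simp only [R]; omega, h1, h2⟩
    · ext i
      rw [permOf_apply]
      rcases lt_trichotomy (i : ℕ) k with hi | hi | hi
      · rw [glue_left _ _ _ hi, permOf_apply]
        have := hL i hi
        exact Nat.sub_add_cancel this
      · rw [glue_mid _ _ _ hi]
        have : i = K := Fin.ext hi
        rw [this, hmax]
      · rw [glue_right _ _ _ hi, permOf_apply]
        have : R ⟨(i : ℕ) - k - 1, by have := i.2; omega⟩ = i := by
          apply Fin.ext; simp only [R]; omega
        simp only [this]

lemma card_Av132 (n : ℕ) : (Av132 n).card = catalan n := by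
  induction n using Nat.strong_induction_on with
  | _ n ih =>
    rcases n with _ | n
    · rw [catalan_zero]; decide
    · rw [catalan_succ]
      rw [Finset.card_eq_sum_card_fiberwise (f := fun σ => σ.symm (Fin.last n))
        (t := Finset.univ) (by intro x _; simp)]
      refine Finset.sum_congr rfl ?_
      intro K _
      obtain ⟨k, hk⟩ := K
      obtain ⟨m, rfl⟩ : ∃ m, n = k + m := ⟨n - k, by omega⟩
      have := card_split k m
      rw [ih k (by omega), ih m (by omega)] at this
      have e : k + m - k = m := by omega
      simp only [e]
      rw [← this]
      congr 1
      ext σ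
      simp only [Finset.mem_filter, and_congr_right_iff]
      intro _
      rw [Equiv.symm_apply_eq, Fin.ext_iff, Fin.val_last]
      exact eq_comm


/-- the extremal word built from a shorter word -/
def extFun {l m : ℕ} (τ : Equiv.Perm (Fin l)) (i : Fin (l + m + 3)) : Fin (l + m + 3) :=
  if (i : ℕ) = 0 then ⟨l + m + 2, by omega⟩
  else if h : (i : ℕ) ≤ l ∧ 0 < (i : ℕ) then
    ⟨(τ ⟨(i : ℕ) - 1, by omega⟩ : ℕ) + 1,
      by have := (τ ⟨(i : ℕ) - 1, by omega⟩).2; omega⟩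
  else if (i : ℕ) = l + m + 2 then ⟨0, by omega⟩
  else i

lemma ext_zero {l m : ℕ} (τ : Equiv.Perm (Fin l)) (i : Fin (l + m + 3)) (h : (i : ℕ) = 0) :
    (extFun τ i : ℕ) = l + m + 2 := by
  simp [extFun, h]

lemma ext_left {l m : ℕ} (τ : Equiv.Perm (Fin l)) (i : Fin (l + m + 3)) (h : 0 < (i : ℕ))
    (h2 : (i : ℕ) ≤ l) :
    (extFun τ i : ℕ) = (τ ⟨(i : ℕ) - 1, by omega⟩ : ℕ) + 1 := by
  have h1 : ¬ (i : ℕ) = 0 := by omega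
  unfold extFun
  rw [if_neg h1, dif_pos ⟨h2, h⟩]

lemma ext_mid {l m : ℕ} (τ : Equiv.Perm (Fin l)) (i : Fin (l + m + 3)) (h : l < (i : ℕ))
    (h2 : (i : ℕ) < l + m + 2) : (extFun τ i : ℕ) = i := by
  unfold extFun
  rw [if_neg (by omega), dif_neg (by omega), if_neg (by omega)]

lemma ext_last {l m : ℕ} (τ : Equiv.Perm (Fin l)) (i : Fin (l + m + 3))
    (h2 : (i : ℕ) = l + m + 2) : (extFun τ i : ℕ) = 0 := by
  unfold extFun
  rw [if_neg (by omega), dif_neg (by omega), if_pos (by omega)]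

lemma ext_facts {l m : ℕ} (τ : Equiv.Perm (Fin l)) (i : Fin (l + m + 3)) :
    ((i : ℕ) = 0 ∧ (extFun τ i : ℕ) = l + m + 2) ∨
    (0 < (i : ℕ) ∧ (i : ℕ) ≤ l ∧ 0 < (extFun τ i : ℕ) ∧ (extFun τ i : ℕ) ≤ l) ∨
    (l < (i : ℕ) ∧ (i : ℕ) < l + m + 2 ∧ (extFun τ i : ℕ) = i) ∨
    ((i : ℕ) = l + m + 2 ∧ (extFun τ i : ℕ) = 0) := by
  have hi := i.2
  by_cases h0 : (i : ℕ) = 0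
  · exact Or.inl ⟨h0, ext_zero τ i h0⟩
  by_cases h1 : (i : ℕ) ≤ l
  · refine Or.inr (Or.inl ⟨by omega, h1, ?_⟩)
    rw [ext_left τ i (by omega) h1]
    have := (τ ⟨(i : ℕ) - 1, by omega⟩).2
    omega
  by_cases h2 : (i : ℕ) = l + m + 2
  · exact Or.inr (Or.inr (Or.inr ⟨h2, ext_last τ i h2⟩))
  · exact Or.inr (Or.inr (Or.inl ⟨by omega, by omega, ext_mid τ i (by omega) (by omega)⟩))

lemma ext_inj {l m : ℕ} (τ : Equiv.Perm (Fin l)) :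
    Function.Injective (extFun (m := m) τ) := by
  intro i j hij
  have hv : (extFun τ i : ℕ) = extFun τ j := by rw [hij]
  apply Fin.ext
  have fi := ext_facts τ i
  have fj := ext_facts τ j
  by_cases h : (0 < (i : ℕ) ∧ (i : ℕ) ≤ l) ∧ (0 < (j : ℕ) ∧ (j : ℕ) ≤ l)
  · rw [ext_left τ i h.1.1 h.1.2, ext_left τ j h.2.1 h.2.2] at hv
    have := perm_val_inj τ (Nat.add_right_cancel hv)
    simp only at this
    omega
  · omega

lemma ext_avoids {l m : ℕ} (τ : Equiv.Perm (Fin l)) (hτ : Avoids132 τ) :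
    Avoids132 (permOf (extFun (m := m) τ) (ext_inj τ)) := by
  rintro ⟨a, b, c, hab, hbc, h1, h2⟩
  simp only [permOf_apply, Fin.lt_def] at *
  have fa := ext_facts τ a
  have fb := ext_facts τ b
  have fc := ext_facts τ c
  by_cases h : 0 < (a : ℕ) ∧ (c : ℕ) ≤ l
  · rw [ext_left τ a (by omega) (by omega), ext_left τ c (by omega) (by omega)] at h1
    rw [ext_left τ b (by omega) (by omega), ext_left τ c (by omega) (by omega)] at h2
    exact hτ ⟨_, _, _, by rw [Fin.lt_def]; dsimp only; omega,
        by rw [Fin.lt_def]; dsimp only; omega, Nat.lt_of_add_lt_add_right h1,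
        Nat.lt_of_add_lt_add_right h2⟩
  · omega

/-- the positions which may match -/
def midSet (l m : ℕ) : Finset (Fin (l + m + 3)) :=
  Finset.univ.filter (fun i => l < (i : ℕ) ∧ (i : ℕ) < l + m + 2)

lemma card_midSet (l m : ℕ) : (midSet l m).card = m + 1 := by
  have : midSet l m = Finset.Ioo (⟨l, by omega⟩ : Fin (l + m + 3)) ⟨l + m + 2, by omega⟩ := by
    ext i; simp [midSet, Fin.lt_def]
  rw [this, Fin.card_Ioo]; simp only; omega

lemma match_split {n l : ℕ} (σ : Equiv.Perm (Fin n)) (i : Fin n)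
    (h : MatchesMMP 0 1 l 1 σ i) :
    (∃ j, j < i ∧ σ i < σ j) ∧ (∃ j, i < j ∧ σ j < σ i) ∧
    l ≤ (Finset.univ.filter (fun j => j < i ∧ σ j < σ i)).card := by
  obtain ⟨_, hb, hc, hd⟩ := h
  obtain ⟨j, hj⟩ := Finset.card_pos.mp hb
  obtain ⟨j', hj'⟩ := Finset.card_pos.mp hd
  exact ⟨⟨j, by simpa using hj⟩, ⟨j', by simpa using hj'⟩, hc⟩

lemma match_mem {l m : ℕ} (σ : Equiv.Perm (Fin (l + m + 3))) (i : Fin (l + m + 3))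
    (h : MatchesMMP 0 1 l 1 σ i) : i ∈ midSet l m := by
  obtain ⟨⟨j, hj, hj2⟩, ⟨j', hj', _⟩, hc⟩ := match_split σ i h
  have hlt : (Finset.univ.filter (fun j => j < i ∧ σ j < σ i)).card < (Finset.Iio i).card := by
    apply Finset.card_lt_card
    rw [Finset.ssubset_iff_of_subset]
    · exact ⟨j, by simpa using hj, by simp [hj2.le]⟩
    · intro t ht
      simp only [Finset.mem_filter, Finset.mem_univ, true_and, Finset.mem_Iio] at ht ⊢
      exact ht.1
  rw [Fin.card_Iio] at hlt
  simp only [midSet, Finset.mem_filter, Finset.mem_univ, true_and]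
  rw [Fin.lt_def] at hj'
  omega

lemma mmp_le {l m : ℕ} (σ : Equiv.Perm (Fin (l + m + 3))) : mmp 0 1 l 1 σ ≤ m + 1 := by
  rw [← card_midSet l m]
  apply Finset.card_le_card
  intro i hi
  exact match_mem σ i (Finset.mem_filter.mp hi).2

lemma mmp_eq_iff {l m : ℕ} (σ : Equiv.Perm (Fin (l + m + 3))) :
    mmp 0 1 l 1 σ = m + 1 ↔
      ∀ i : Fin (l + m + 3), l < (i : ℕ) → (i : ℕ) < l + m + 2 → MatchesMMP 0 1 l 1 σ i := by
  have hsub : Finset.univ.filter (MatchesMMP 0 1 l 1 σ) ⊆ midSet l m := fun i hi =>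
    match_mem σ i (Finset.mem_filter.mp hi).2
  constructor
  · intro h i h1 h2
    have he := Finset.eq_of_subset_of_card_le hsub (by rw [card_midSet]; exact h.ge)
    have : i ∈ midSet l m := by simp [midSet, h1, h2]
    rw [← he] at this
    exact (Finset.mem_filter.mp this).2
  · intro h
    unfold mmp
    rw [← card_midSet l m]
    congr 1
    apply Finset.Subset.antisymm hsub
    intro i hi
    simp only [midSet, Finset.mem_filter, Finset.mem_univ, true_and] at hi ⊢
    exact h i hi.1 hi.2

lemma ext_matches {l m : ℕ} (τ : Equiv.Perm (Fin l)) (i : Fin (l + m + 3))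
    (h1 : l < (i : ℕ)) (h2 : (i : ℕ) < l + m + 2) :
    MatchesMMP 0 1 l 1 (permOf (extFun (m := m) τ) (ext_inj τ)) i := by
  have hi := ext_mid τ i h1 h2
  refine ⟨Nat.zero_le _, ?_, ?_, ?_⟩
  · apply Finset.card_pos.mpr
    refine ⟨⟨0, by omega⟩, ?_⟩
    simp only [Finset.mem_filter, Finset.mem_univ, true_and, permOf_apply, Fin.lt_def]
    rw [hi, ext_zero τ _ rfl]
    exact ⟨by omega, h2⟩
  · have : (Finset.Ioo (⟨0, by omega⟩ : Fin (l + m + 3)) ⟨l + 1, by omega⟩).card = l := by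
      rw [Fin.card_Ioo]; simp
    refine this.ge.trans ?_
    apply Finset.card_le_card
    intro t ht
    simp only [Finset.mem_filter, Finset.mem_univ, true_and, permOf_apply, Fin.lt_def,
      Finset.mem_Ioo] at ht ⊢
    have := ext_facts τ t
    omega
  · apply Finset.card_pos.mpr
    refine ⟨⟨l + m + 2, by omega⟩, ?_⟩
    simp only [Finset.mem_filter, Finset.mem_univ, true_and, permOf_apply, Fin.lt_def]
    rw [hi, ext_last τ _ rfl]
    exact ⟨h2, by omega⟩

lemma shape_of_max {l m : ℕ} (hl : 1 ≤ l) (σ : Equiv.Perm (Fin (l + m + 3)))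
    (hav : Avoids132 σ)
    (hm : ∀ i : Fin (l + m + 3), l < (i : ℕ) → (i : ℕ) < l + m + 2 → MatchesMMP 0 1 l 1 σ i) :
    (∀ i : Fin (l + m + 3), (i : ℕ) = 0 → (σ i : ℕ) = l + m + 2) ∧
    (∀ i : Fin (l + m + 3), (i : ℕ) = l + m + 2 → (σ i : ℕ) = 0) ∧
    (∀ i : Fin (l + m + 3), l < (i : ℕ) → (i : ℕ) < l + m + 2 → (σ i : ℕ) = i) ∧
    (∀ i : Fin (l + m + 3), 0 < (i : ℕ) → (i : ℕ) ≤ l → 0 < (σ i : ℕ) ∧ (σ i : ℕ) ≤ l) := by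
  set Z : Fin (l + m + 3) := ⟨0, by omega⟩ with hZ
  set N : Fin (l + m + 3) := ⟨l + m + 2, by omega⟩ with hN
  have ne : ∀ a b : Fin (l + m + 3), a < b → σ a ≠ σ b := fun a b hab h =>
    hab.ne (σ.injective h)
  have prop : ∀ a b c : Fin (l + m + 3), a < b → b < c → σ c < σ b → σ c < σ a := by
    intro a b c hab hbc h
    by_contra hc
    exact hav ⟨a, b, c, hab, hbc, lt_of_le_of_ne (not_lt.mp hc) (ne a c (hab.trans hbc)), h⟩
  have hP : ∀ v : ℕ, ∀ i : Fin (l + m + 3), (i : ℕ) = v → l < v → v < l + m + 2 →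
      ∀ j, Z < j → j < i → σ j < σ i := by
    intro v
    induction v with
    | zero => intro i _ h; omega
    | succ v ih =>
      intro i hiv h1 h2 j hj hji
      obtain ⟨_, _, hc⟩ := match_split σ i (hm i (by omega) (by omega))
      by_contra hcon
      have hbig : σ i < σ j := lt_of_le_of_ne (not_lt.mp hcon) (ne j i hji).symm
      by_cases hv : v = l
      · have : (Finset.univ.filter (fun j => j < i ∧ σ j < σ i)).card
            < (Finset.Ioo Z i).card := by
          apply Finset.card_lt_card
          rw [Finset.ssubset_iff_of_subset]
          · exact ⟨j, by simp [hj, hji], by simp [hbig.le]⟩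
          · intro t ht
            simp only [Finset.mem_filter, Finset.mem_univ, true_and, Finset.mem_Ioo] at ht ⊢
            refine ⟨?_, ht.1⟩
            by_contra hz
            have htz : t ≤ Z := not_lt.mp hz
            have := prop t j i (lt_of_le_of_lt htz hj) hji hbig
            exact absurd this (not_lt.mpr ht.2.le)
        rw [Fin.card_Ioo] at this
        simp only [hZ] at this
        omega
      · have hp : ((⟨v, by omega⟩ : Fin (l + m + 3)) : ℕ) = v := rfl
        set p : Fin (l + m + 3) := ⟨v, by omega⟩ with hpdef
        have hpi : p < i := by rw [Fin.lt_def]; omega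
        have hpb : σ i < σ p := by
          rcases lt_trichotomy j p with h | h | h
          · exact hbig.trans (ih p hp (by omega) (by omega) j hj h)
          · rw [← h]; exact hbig
          · rw [Fin.lt_def] at h hji; omega
        have hpos : 0 < (Finset.univ.filter (fun j => j < i ∧ σ j < σ i)).card := by omega
        obtain ⟨t, ht⟩ := Finset.card_pos.mp hpos
        simp only [Finset.mem_filter, Finset.mem_univ, true_and] at ht
        rcases lt_trichotomy t p with h | h | h
        · exact absurd (prop t p i h hpi hpb) (not_lt.mpr ht.2.le)
        · rw [h] at ht; exact absurd hpb (not_lt.mpr ht.2.le)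
        · have := ht.1; rw [Fin.lt_def] at h this; omega
  have hmid : ∀ i : Fin (l + m + 3), l < (i : ℕ) → (i : ℕ) < l + m + 2 →
      ∀ j, Z < j → j < i → σ j < σ i := fun i h1 h2 => hP i i rfl h1 h2
  have hZlt : ∀ i : Fin (l + m + 3), l < (i : ℕ) → (i : ℕ) < l + m + 2 → σ i < σ Z := by
    intro i h1 h2
    obtain ⟨⟨j, hj, hj2⟩, _, _⟩ := match_split σ i (hm i h1 h2)
    rcases Nat.eq_zero_or_pos (j : ℕ) with h | h
    · have : j = Z := Fin.ext h
      rwa [← this]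
    · exact absurd (hmid i h1 h2 j h hj) (not_lt.mpr hj2.le)
  have hNlt : ∀ j, j < N → σ N < σ j := by
    have hpv : ((⟨l + m + 1, by omega⟩ : Fin (l + m + 3)) : ℕ) = l + m + 1 := rfl
    set p : Fin (l + m + 3) := ⟨l + m + 1, by omega⟩ with hpdef
    obtain ⟨_, ⟨j', hj', hj2⟩, _⟩ := match_split σ p (hm p (by omega) (by omega))
    have hjN : j' = N := by
      apply Fin.ext
      rw [Fin.lt_def] at hj'
      have := j'.2
      simp only [hN]; omega
    rw [hjN] at hj2 hj'
    intro j hj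
    rcases lt_trichotomy j p with h | h | h
    · exact prop j p N h hj' hj2
    · rw [h]; exact hj2
    · rw [Fin.lt_def] at h hj; simp only [hN] at hj; omega
  have hmval : ∀ i : Fin (l + m + 3), l < (i : ℕ) → (i : ℕ) < l + m + 2 → (σ i : ℕ) = i := by
    intro i h1 h2
    have hiN : i < N := h2
    have hZi : Z < i := by rw [Fin.lt_def]; simp only [hZ]; omega
    have e : Finset.univ.filter (fun j => σ j < σ i) = insert N (Finset.Ioo Z i) := by
      ext t
      simp only [Finset.mem_filter, Finset.mem_univ, true_and, Finset.mem_insert,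
        Finset.mem_Ioo]
      constructor
      · intro ht
        by_cases htN : t = N
        · exact Or.inl htN
        right
        have htN' : (t : ℕ) < l + m + 2 := by
          have := t.2
          have h3 : (t : ℕ) ≠ l + m + 2 := fun h => htN (Fin.ext h)
          omega
        constructor
        · by_contra hz
          have : t = Z := le_antisymm (not_lt.mp hz) (Nat.zero_le _)
          rw [this] at ht
          exact absurd (hZlt i h1 h2) (not_lt.mpr ht.le)
        · by_contra hti
          rcases eq_or_lt_of_le (not_lt.mp hti) with h | h
          · rw [h] at ht; exact lt_irrefl _ ht
          · have h' : (i : ℕ) < t := h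
            exact absurd (hmid t (by omega) htN' i hZi h) (not_lt.mpr ht.le)
      · rintro (rfl | ht)
        · exact hNlt i hiN
        · exact hmid i h1 h2 t ht.1 ht.2
    rw [val_eq_card, e, Finset.card_insert_of_notMem, Fin.card_Ioo]
    · simp only [hZ]; omega
    · simp only [Finset.mem_Ioo, not_and, not_lt]
      intro _; exact hiN.le
  have hleft : ∀ i : Fin (l + m + 3), 0 < (i : ℕ) → (i : ℕ) ≤ l →
      0 < (σ i : ℕ) ∧ (σ i : ℕ) ≤ l := by
    intro i h1 h2
    have hpv : ((⟨l + 1, by omega⟩ : Fin (l + m + 3)) : ℕ) = l + 1 := rfl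
    set p : Fin (l + m + 3) := ⟨l + 1, by omega⟩ with hpdef
    have a := hmval p (by omega) (by omega)
    have b := hmid p (by omega) (by omega) i h1 (by rw [Fin.lt_def]; omega)
    have c := hNlt i (by rw [Fin.lt_def]; simp only [hN]; omega)
    rw [Fin.lt_def] at b c
    omega
  have hNval : (σ N : ℕ) = 0 := by
    rw [val_eq_card, Finset.card_eq_zero, Finset.filter_eq_empty_iff]
    intro t _ ht
    have htN : t < N := by
      rw [Fin.lt_def]
      have := t.2
      have h3 : (t : ℕ) ≠ l + m + 2 := fun h => by
        have : t = N := Fin.ext h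
        rw [this] at ht; exact lt_irrefl _ ht
      simp only [hN]; omega
    exact absurd (hNlt t htN) (not_lt.mpr ht.le)
  have hZval : (σ Z : ℕ) = l + m + 2 := by
    obtain ⟨t, ht⟩ := σ.surjective N
    have htv : (σ t : ℕ) = l + m + 2 := by rw [ht]
    by_cases h0 : (t : ℕ) = 0
    · have : t = Z := Fin.ext h0
      rw [← this]; exact htv
    exfalso
    have := t.2
    by_cases h1 : (t : ℕ) ≤ l
    · have := hleft t (by omega) h1; omega
    by_cases h2 : (t : ℕ) = l + m + 2
    · have : t = N := Fin.ext h2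
      rw [this] at htv; omega
    · have := hmval t (by omega) (by omega); omega
  refine ⟨fun i hi => ?_, fun i hi => ?_, hmval, hleft⟩
  · have : i = Z := Fin.ext hi
    rw [this]; exact hZval
  · have : i = N := Fin.ext hi
    rw [this]; exact hNval

lemma card_extremal {l m : ℕ} (hl : 1 ≤ l) :
    ((Av132 (l + m + 3)).filter (fun σ => mmp 0 1 l 1 σ = m + 1)).card = catalan l := by
  rw [← card_Av132 l]
  symm
  apply Finset.card_bij (fun τ _ => permOf (extFun (m := m) τ) (ext_inj τ))
  · intro τ hτ
    simp only [Av132, Finset.mem_filter, Finset.mem_univ, true_and] at hτ ⊢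
    exact ⟨ext_avoids τ hτ, (mmp_eq_iff _).mpr (ext_matches τ)⟩
  · intro τ _ τ' _ h
    ext i
    have hi := i.2
    have := congrArg (fun e : Equiv.Perm (Fin (l + m + 3)) => (e ⟨i + 1, by omega⟩ : ℕ)) h
    simp only [permOf_apply] at this
    rw [ext_left τ _ (by simp) (by simp only; omega),
      ext_left τ' _ (by simp) (by simp only; omega)] at this
    simpa using this
  · intro σ hσ
    simp only [Av132, Finset.mem_filter, Finset.mem_univ, true_and] at hσ
    obtain ⟨hav, hmm⟩ := hσ
    obtain ⟨s0, sN, sm, sl⟩ := shape_of_max hl σ hav ((mmp_eq_iff σ).mp hmm)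
    let P : Fin l → Fin (l + m + 3) := fun i => ⟨i + 1, by omega⟩
    have hP : ∀ i, 0 < (σ (P i) : ℕ) ∧ (σ (P i) : ℕ) ≤ l := fun i =>
      sl (P i) (Nat.succ_pos _) i.2
    have fi : Function.Injective (fun i : Fin l => (⟨(σ (P i) : ℕ) - 1, by
        have := hP i; omega⟩ : Fin l)) := by
      intro i j hij
      simp only [Fin.mk.injEq] at hij
      have h1 := hP i
      have h2 := hP j
      have := perm_val_inj σ (i := P i) (j := P j) (by omega)
      exact Fin.ext (Nat.succ_injective this)
    refine ⟨permOf _ fi, ?_, ?_⟩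
    · simp only [Av132, Finset.mem_filter, Finset.mem_univ, true_and]
      rintro ⟨a, b, c, hab, hbc, h1, h2⟩
      simp only [permOf_apply, Fin.lt_def] at h1 h2
      have hA := hP a
      have hB := hP b
      have hC := hP c
      exact hav ⟨P a, P b, P c, Nat.succ_lt_succ hab, Nat.succ_lt_succ hbc,
        by rw [Fin.lt_def]; omega, by rw [Fin.lt_def]; omega⟩
    · ext i
      rw [permOf_apply]
      have hi := i.2
      by_cases h0 : (i : ℕ) = 0
      · rw [ext_zero _ _ h0, s0 i h0]
      by_cases h1 : (i : ℕ) ≤ l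
      · rw [ext_left _ _ (by omega) h1, permOf_apply]
        have e : P ⟨(i : ℕ) - 1, by omega⟩ = i := by
          apply Fin.ext; simp only [P]; omega
        have := sl i (by omega) h1
        simp only [e]
        omega
      by_cases h2 : (i : ℕ) = l + m + 2
      · rw [ext_last _ _ h2, sN i h2]
      · rw [ext_mid _ _ (by omega) (by omega), sm i (by omega) (by omega)]

lemma coeff_Q (n a b c d r : ℕ) : (Q n a b c d).coeff r =
    (((Av132 n).filter (fun σ => mmp a b c d σ = r)).card : ℤ) := by
  unfold Q
  rw [Polynomial.finsetSum_coeff]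
  simp only [Polynomial.coeff_X_pow]
  rw [Finset.card_filter]
  push_cast
  refine Finset.sum_congr rfl fun σ _ => ?_
  by_cases h : mmp a b c d σ = r
  · simp [h]
  · simp [h, Ne.symm h]

/-- for `ℓ ≥ 1` and `n ≥ 3 + ℓ`, the highest power of `x` in
`Q_{n,132}^{(0,1,ℓ,1)}(x)` is `x^{n-2-ℓ}`, with coefficient `C_ℓ`. -/
theorem stmt9 (l n : ℕ) (hl : 1 ≤ l) (hn : 3 + l ≤ n) :
    (Q n 0 1 l 1).coeff (n - 2 - l) = (catalan l : ℤ) ∧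
    ∀ r : ℕ, n - 2 - l < r → (Q n 0 1 l 1).coeff r = 0 := by
  obtain ⟨m, rfl⟩ : ∃ m, n = l + m + 3 := ⟨n - l - 3, by omega⟩
  have e : l + m + 3 - 2 - l = m + 1 := by omega
  rw [e]
  constructor
  · rw [coeff_Q, card_extremal hl]
  · intro r hr
    rw [coeff_Q, Nat.cast_eq_zero, Finset.card_eq_zero, Finset.filter_eq_empty_iff]
    intro σ _ h
    have := mmp_le σ
    omega
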